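/- Assume all influences are non-negative. Then the pessimistic equilibrium function p ↦ q̲(p) is piecewise affine with at most 2n+1 pieces: there exist an integer m ≤ 2n and prices p_1 ≥ p_2 ≥ ⋯ ≥ p_m such that q̲(p) = 0 (the all-zeros vector) for every p ≥ p_1, q̲(p) = 1 (the all-ones vector) for every p < p_m, and on each interval [p_{t+1}, p_t) for 1 ≤ t ≤ m−1 every coordinate of q̲(p) is an affine function of p. -/

import Mathlib

open Filter Topology

/-- med{0,1,x} = max(0, min(1, x)). -/
noncomputable def med (x : ℝ) : ℝ := max 0 (min 1 x)

/-- The transfer function `f_p` of the pricing game. -/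
noncomputable def transfer {ι : Type*} [Fintype ι] (a b : ι → ℝ)
    (T : Matrix ι ι ℝ) (p : ℝ) (q : ι → ℝ) : ι → ℝ :=
  fun i => med ((b i - p + ∑ j, T j i * q j) / (b i - a i))

section Med

lemma med_mono : Monotone med := fun _ _ h => max_le_max le_rfl (min_le_min le_rfl h)

lemma continuous_med : Continuous med := by
  unfold med
  fun_prop

lemma med_nonneg (x : ℝ) : 0 ≤ med x := le_max_left _ _

lemma med_le_one (x : ℝ) : med x ≤ 1 := max_le zero_le_one (min_le_left _ _)

lemma med_of_nonpos {x : ℝ} (h : x ≤ 0) : med x = 0 :=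
  max_eq_left ((min_le_right _ _).trans h)

lemma med_of_one_le {x : ℝ} (h : 1 ≤ x) : med x = 1 := by
  simp [med, min_eq_left h]

lemma med_of_mem_Icc {x : ℝ} (h0 : 0 ≤ x) (h1 : x ≤ 1) : med x = x := by
  simp [med, h0, h1]

lemma med_eq_zero_iff {x : ℝ} : med x = 0 ↔ x ≤ 0 := by
  refine ⟨fun h => ?_, med_of_nonpos⟩
  by_contra! hx
  have : 0 < med x := lt_max_of_lt_right (lt_min one_pos hx)
  exact this.ne' h

end Med

section Equilibrium

variable {ι : Type*} [Fintype ι] {a b : ι → ℝ} {T : Matrix ι ι ℝ}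

/-- The unclamped response of agent `i`, whose truncation to `[0,1]` is the transfer function. -/
noncomputable def response (a b : ι → ℝ) (T : Matrix ι ι ℝ) (p : ℝ) (q : ι → ℝ) (i : ι) : ℝ :=
  (b i - p + ∑ j, T j i * q j) / (b i - a i)

lemma transfer_apply (p : ℝ) (q : ι → ℝ) (i : ι) :
    transfer a b T p q i = med (response a b T p q i) := rfl

lemma response_affine (l p p' : ℝ) (q q' : ι → ℝ) (i : ι) :
    response a b T (l * p + (1 - l) * p') (fun j => l * q j + (1 - l) * q' j) i =
      l * response a b T p q i + (1 - l) * response a b T p' q' i := by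
  have h : ∑ j, T j i * (l * q j + (1 - l) * q' j) =
      l * ∑ j, T j i * q j + (1 - l) * ∑ j, T j i * q' j := by
    rw [Finset.mul_sum, Finset.mul_sum, ← Finset.sum_add_distrib]
    exact Finset.sum_congr rfl fun j _ => by ring
  simp only [response, h]
  ring

lemma response_mono (hab : ∀ i, a i < b i) (hT : ∀ i j, 0 ≤ T j i) {p p' : ℝ} {q q' : ι → ℝ}
    (hp : p' ≤ p) (hq : q ≤ q') (i : ι) : response a b T p q i ≤ response a b T p' q' i := by
  refine div_le_div_of_nonneg_right ?_ (sub_pos.2 (hab i)).le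
  have : ∑ j, T j i * q j ≤ ∑ j, T j i * q' j :=
    Finset.sum_le_sum fun j _ => mul_le_mul_of_nonneg_left (hq j) (hT i j)
  linarith

lemma transfer_mono (hab : ∀ i, a i < b i) (hT : ∀ i j, 0 ≤ T j i) {p p' : ℝ} {q q' : ι → ℝ}
    (hp : p' ≤ p) (hq : q ≤ q') : transfer a b T p q ≤ transfer a b T p' q' :=
  fun i => med_mono (response_mono hab hT hp hq i)

lemma tendsto_response {α : Type*} {l : Filter α} {u : α → ℝ} {v : α → ι → ℝ} {p : ℝ}
    {q : ι → ℝ} (hu : Tendsto u l (𝓝 p)) (hv : ∀ i, Tendsto (fun x => v x i) l (𝓝 (q i)))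
    (i : ι) : Tendsto (fun x => response a b T (u x) (v x) i) l (𝓝 (response a b T p q i)) :=
  ((tendsto_const_nhds.sub hu).add
    (tendsto_finsetSum _ fun j _ => (hv j).const_mul (T j i))).div_const _

lemma tendsto_transfer {α : Type*} {l : Filter α} {u : α → ℝ} {v : α → ι → ℝ} {p : ℝ}
    {q : ι → ℝ} (hu : Tendsto u l (𝓝 p)) (hv : ∀ i, Tendsto (fun x => v x i) l (𝓝 (q i)))
    (i : ι) : Tendsto (fun x => transfer a b T (u x) (v x) i) l (𝓝 (transfer a b T p q i)) :=
  (continuous_med.tendsto _).comp (tendsto_response hu hv i)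

/-- `q p` is the least non-negative prefixed point of the transfer function, for each price `p`,
and it is a fixed point. -/
structure IsLeastEquilibrium (a b : ι → ℝ) (T : Matrix ι ι ℝ) (q : ℝ → ι → ℝ) : Prop where
  fixed : ∀ p, transfer a b T p (q p) = q p
  le_of_transfer_le : ∀ p r, 0 ≤ r → transfer a b T p r ≤ r → q p ≤ r

lemma isLeastEquilibrium_of_tendsto (hab : ∀ i, a i < b i) (hT : ∀ i j, 0 ≤ T j i)
    {q : ℝ → ι → ℝ}
    (hq : ∀ p i, Tendsto (fun m : ℕ => (transfer a b T p)^[m] (fun _ => 0) i)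
      atTop (𝓝 (q p i))) : IsLeastEquilibrium a b T q where
  fixed p := by
    funext i
    refine tendsto_nhds_unique (tendsto_transfer tendsto_const_nhds (hq p) i) ?_
    simpa only [Function.iterate_succ_apply'] using (tendsto_add_atTop_iff_nat 1).2 (hq p i)
  le_of_transfer_le p r h0 hr i := by
    refine le_of_tendsto' (hq p i) fun m => ?_
    suffices h : (transfer a b T p)^[m] (fun _ => 0) ≤ r from h i
    induction m with
    | zero => exact h0
    | succ m ih =>
      rw [Function.iterate_succ_apply']
      exact (transfer_mono hab hT le_rfl ih).trans hr

namespace IsLeastEquilibrium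

variable {q : ℝ → ι → ℝ}

lemma apply_eq (hq : IsLeastEquilibrium a b T q) (p : ℝ) (i : ι) :
    q p i = med (response a b T p (q p) i) := (congrFun (hq.fixed p) i).symm

lemma nonneg (hq : IsLeastEquilibrium a b T q) (p : ℝ) : 0 ≤ q p := fun i => by
  rw [hq.apply_eq]; exact med_nonneg _

lemma le_one (hq : IsLeastEquilibrium a b T q) (p : ℝ) (i : ι) : q p i ≤ 1 := by
  rw [hq.apply_eq]; exact med_le_one _

lemma antitone (hq : IsLeastEquilibrium a b T q) (hab : ∀ i, a i < b i)
    (hT : ∀ i j, 0 ≤ T j i) : Antitone q := fun p p' h =>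
  hq.le_of_transfer_le p' (q p) (hq.nonneg p)
    ((transfer_mono hab hT h le_rfl).trans (hq.fixed p).le)

lemma tendsto_nhdsGT (hq : IsLeastEquilibrium a b T q) (hab : ∀ i, a i < b i)
    (hT : ∀ i j, 0 ≤ T j i) (p : ℝ) (i : ι) :
    Tendsto (fun x => q x i) (𝓝[>] p) (𝓝 (q p i)) := by
  have hanti := hq.antitone hab hT
  have hlim : ∀ j, ∃ y, Tendsto (fun x => q x j) (𝓝[>] p) (𝓝 y) := fun j => by
    have hj : Antitone fun x => q x j := fun _ _ h => hanti h j
    exact ⟨_, hj.tendsto_nhdsGT p⟩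
  choose r hr using hlim
  have hid : Tendsto (fun x : ℝ => x) (𝓝[>] p) (𝓝 p) :=
    tendsto_nhdsWithin_of_tendsto_nhds tendsto_id
  have hfix : transfer a b T p r = r := by
    funext j
    refine tendsto_nhds_unique (tendsto_transfer hid hr j) ?_
    simpa only [hq.fixed] using hr j
  have hle : r ≤ q p := fun j => le_of_tendsto (hr j) <| by
    filter_upwards [self_mem_nhdsWithin] with x hx using hanti (le_of_lt hx) j
  have hge : q p ≤ r := hq.le_of_transfer_le p r
    (fun j => ge_of_tendsto' (hr j) fun x => hq.nonneg x j) hfix.le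
  rw [le_antisymm hge hle]
  exact hr i

lemma eq_one_of_le (hq : IsLeastEquilibrium a b T q) (hab : ∀ i, a i < b i)
    (hT : ∀ i j, 0 ≤ T j i) {p : ℝ} {i : ι} (hp : p ≤ a i) : q p i = 1 := by
  rw [hq.apply_eq]
  refine med_of_one_le ((one_le_div (sub_pos.2 (hab i))).2 ?_)
  have : 0 ≤ ∑ j, T j i * q p j :=
    Finset.sum_nonneg fun j _ => mul_nonneg (hT i j) (hq.nonneg p j)
  linarith

lemma eq_zero_of_forall_le (hq : IsLeastEquilibrium a b T q) (hab : ∀ i, a i < b i)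
    {p : ℝ} (hp : ∀ i, b i ≤ p) : q p = 0 := by
  refine le_antisymm (hq.le_of_transfer_le p 0 le_rfl fun i => ?_) (hq.nonneg p)
  rw [transfer_apply, med_of_nonpos]
  · rfl
  · refine div_nonpos_of_nonpos_of_nonneg ?_ (sub_pos.2 (hab i)).le
    simpa using hp i

/-- Each agent has a price from which on it does not buy. -/
lemma exists_zero_threshold (hq : IsLeastEquilibrium a b T q) (hab : ∀ i, a i < b i)
    (hT : ∀ i j, 0 ≤ T j i) (i : ι) : ∃ z, ∀ p, q p i = 0 ↔ z ≤ p := by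
  have hanti := hq.antitone hab hT
  set S := {p | q p i = 0}
  have hne : S.Nonempty := by
    obtain ⟨B, hB⟩ := (Set.finite_range b).bddAbove
    exact ⟨B, congrFun (hq.eq_zero_of_forall_le hab fun j => hB ⟨j, rfl⟩) i⟩
  have hbdd : BddBelow S := ⟨a i, fun p hp => by
    by_contra! h
    have h1 := hq.eq_one_of_le hab hT h.le
    exact zero_ne_one ((show q p i = 0 from hp).symm.trans h1)⟩
  have hgt : ∀ p, sInf S < p → q p i = 0 := fun p hp => by
    obtain ⟨x, hx, hxp⟩ := exists_lt_of_csInf_lt hne hp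
    exact le_antisymm ((hanti hxp.le i).trans (show q x i = 0 from hx).le) (hq.nonneg p i)
  refine ⟨sInf S, fun p => ⟨fun h => csInf_le hbdd h, fun h => ?_⟩⟩
  refine tendsto_nhds_unique (hq.tendsto_nhdsGT hab hT p i) ?_
  refine tendsto_const_nhds.congr' ?_
  filter_upwards [self_mem_nhdsWithin] with x hx using (hgt x (h.trans_lt hx)).symm

/-- Each agent has a price below which it buys for sure, and above which its unclamped response
is at most `1`. -/
lemma exists_one_threshold (hq : IsLeastEquilibrium a b T q) (hab : ∀ i, a i < b i)
    (hT : ∀ i j, 0 ≤ T j i) (i : ι) :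
    ∃ o, (∀ p < o, q p i = 1) ∧ ∀ p, o ≤ p → response a b T p (q p) i ≤ 1 := by
  have hanti := hq.antitone hab hT
  set S := {p | q p i = 1}
  have hne : S.Nonempty := ⟨a i, hq.eq_one_of_le hab hT le_rfl⟩
  have hbdd : BddAbove S := by
    obtain ⟨B, hB⟩ := (Set.finite_range b).bddAbove
    refine ⟨B, fun p hp => ?_⟩
    by_contra! h
    have h0 := congrFun (hq.eq_zero_of_forall_le hab fun j => (hB ⟨j, rfl⟩).trans h.le) i
    exact zero_ne_one (h0.symm.trans (show q p i = 1 from hp))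
  refine ⟨sSup S, fun p hp => ?_, fun p hp => ?_⟩
  · obtain ⟨x, hx, hpx⟩ := exists_lt_of_lt_csSup hne hp
    exact le_antisymm (hq.le_one p i) ((show q x i = 1 from hx).ge.trans (hanti hpx.le i))
  · have hid : Tendsto (fun x : ℝ => x) (𝓝[>] p) (𝓝 p) :=
      tendsto_nhdsWithin_of_tendsto_nhds tendsto_id
    refine le_of_tendsto (tendsto_response hid (fun j => hq.tendsto_nhdsGT hab hT p j) i) ?_
    filter_upwards [self_mem_nhdsWithin] with x hx
    by_contra! h
    have hxS : x ∈ S := (hq.apply_eq x i).trans (med_of_one_le h.le)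
    exact absurd (le_csSup hbdd hxS) (not_le.2 (hp.trans_lt hx))

/-- A prefixed point that agrees with the least equilibrium on the agents buying with probability
`0` or `1`, and solves the linear equations of the other ones, is the least equilibrium. -/
lemma eq_of_linear_regime (hq : IsLeastEquilibrium a b T q) (hab : ∀ i, a i < b i)
    (hT : ∀ i j, 0 ≤ T j i) {p : ℝ} {r : ι → ℝ} (hr0 : 0 ≤ r) (hr : transfer a b T p r ≤ r)
    (h : ∀ i, (q p i = 0 ∧ r i = 0) ∨ (q p i = 1 ∧ r i = 1) ∨
      (0 < q p i ∧ q p i = response a b T p (q p) i ∧ r i = response a b T p r i)) :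
    q p = r := by
  have hle := hq.le_of_transfer_le p r hr0 hr
  have hev : ∀ᶠ l : ℝ in 𝓝[>] 1, ∀ i, 0 ≤ l * q p i + (1 - l) * r i := by
    refine eventually_all.2 fun i => ?_
    by_cases hi : 0 < q p i
    · have hc : Tendsto (fun l : ℝ => l * q p i + (1 - l) * r i) (𝓝[>] 1) (𝓝 (q p i)) := by
        refine tendsto_nhdsWithin_of_tendsto_nhds ?_
        have : Continuous fun l : ℝ => l * q p i + (1 - l) * r i := by fun_prop
        simpa using this.tendsto 1
      exact (hc.eventually (lt_mem_nhds hi)).mono fun _ => le_of_lt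
    · rcases h i with ⟨h1, h2⟩ | ⟨h1, -⟩ | ⟨h1, -⟩
      · simp [h1, h2]
      · exact absurd (h1 ▸ one_pos) hi
      · exact absurd h1 hi
  obtain ⟨l, hl0, hl1 : 1 < l⟩ := (hev.and self_mem_nhdsWithin).exists
  set w : ι → ℝ := fun i => l * q p i + (1 - l) * r i with hw
  have hwq : w ≤ q p := fun i => by
    have := hle i
    simp only [hw]
    nlinarith
  have hresp : ∀ i, response a b T p w i =
      l * response a b T p (q p) i + (1 - l) * response a b T p r i := fun i => by
    have := response_affine (a := a) (b := b) (T := T) l p p (q p) r i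
    rwa [show l * p + (1 - l) * p = p by ring] at this
  have hwfix : transfer a b T p w ≤ w := fun i => by
    rw [transfer_apply]
    rcases h i with ⟨h1, h2⟩ | ⟨h1, h2⟩ | ⟨-, h1, h2⟩
    · have hq0 : q p i ≤ w i := by simp [hw, h1, h2]
      refine (med_mono (response_mono hab hT le_rfl hwq i)).trans ?_
      rwa [← hq.apply_eq]
    · refine (med_le_one _).trans ?_
      simp [hw, h1, h2]
    · have : response a b T p w i = w i := by rw [hresp, ← h1, ← h2]
      rw [this]
      exact max_le (hl0 i) (min_le_right _ _)
  refine le_antisymm hle fun i => ?_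
  have := hq.le_of_transfer_le p w hl0 hwfix i
  simp only [hw] at this
  nlinarith

/-- The least equilibrium commutes with convex combinations of prices in an interval that no
threshold cuts. -/
lemma convex_combination (hq : IsLeastEquilibrium a b T q) (hab : ∀ i, a i < b i)
    (hT : ∀ i j, 0 ≤ T j i) {s t : ℝ}
    (h : ∀ i, (∀ p ∈ Set.Ico s t, q p i = 0) ∨ (∀ p ∈ Set.Ico s t, q p i = 1) ∨
      ∀ p ∈ Set.Ico s t, 0 < q p i ∧ q p i = response a b T p (q p) i)
    {p p' l : ℝ} (hp : p ∈ Set.Ico s t) (hp' : p' ∈ Set.Ico s t) (hl0 : 0 ≤ l) (hl1 : l ≤ 1) :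
    q (l * p + (1 - l) * p') = fun i => l * q p i + (1 - l) * q p' i := by
  have hl1' : 0 ≤ 1 - l := by linarith
  have hmem : l * p + (1 - l) * p' ∈ Set.Ico s t :=
    convex_Ico s t hp hp' hl0 hl1' (by ring)
  have hr0 : (0 : ι → ℝ) ≤ fun i => l * q p i + (1 - l) * q p' i := fun i =>
    add_nonneg (mul_nonneg hl0 (hq.nonneg p i)) (mul_nonneg hl1' (hq.nonneg p' i))
  refine hq.eq_of_linear_regime hab hT hr0 (fun i => ?_) fun i => ?_
  · rw [transfer_apply, response_affine]
    rcases h i with h | h | h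
    · have h1 := med_eq_zero_iff.1 ((hq.apply_eq p i).symm.trans (h p hp))
      have h2 := med_eq_zero_iff.1 ((hq.apply_eq p' i).symm.trans (h p' hp'))
      rw [med_of_nonpos (by nlinarith)]
      exact hr0 i
    · refine (med_le_one _).trans ?_
      simp [h p hp, h p' hp']
    · rw [← (h p hp).2, ← (h p' hp').2]
      exact max_le (hr0 i) (min_le_right _ _)
  · rcases h i with h | h | h
    · exact .inl ⟨h _ hmem, by simp [h p hp, h p' hp']⟩
    · exact .inr (.inl ⟨h _ hmem, by simp [h p hp, h p' hp']⟩)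
    · refine .inr (.inr ⟨(h _ hmem).1, (h _ hmem).2, ?_⟩)
      rw [response_affine, ← (h p hp).2, ← (h p' hp').2]

end IsLeastEquilibrium

end Equilibrium

/-- A map that commutes with convex combinations on `[s, t)` is affine there. -/
lemma exists_affine_of_convex_combination {ι : Type*} {q : ℝ → ι → ℝ} {s t : ℝ}
    (h : ∀ p ∈ Set.Ico s t, ∀ p' ∈ Set.Ico s t, ∀ l : ℝ, 0 ≤ l → l ≤ 1 →
      q (l * p + (1 - l) * p') = fun i => l * q p i + (1 - l) * q p' i) :
    ∃ c d : ι → ℝ, ∀ p ∈ Set.Ico s t, ∀ i, q p i = c i * p + d i := by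
  rcases le_or_gt t s with hts | hst
  · exact ⟨0, 0, fun p hp => absurd (hp.1.trans_lt hp.2) (not_lt.2 hts)⟩
  have hs : s ∈ Set.Ico s t := ⟨le_rfl, hst⟩
  have key : ∀ x ∈ Set.Ico s t, ∀ y ∈ Set.Ico s t, s < y → x ≤ y → ∀ i,
      (q x i - q s i) * (y - s) = (q y i - q s i) * (x - s) := by
    intro x hx y hy hsy hxy i
    have hys : 0 < y - s := sub_pos.2 hsy
    have hcomb := congrFun (h y hy s hs ((x - s) / (y - s))
      (div_nonneg (sub_nonneg.2 hx.1) hys.le) ((div_le_one hys).2 (by linarith))) i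
    have hx' : (x - s) / (y - s) * y + (1 - (x - s) / (y - s)) * s = x := by
      field_simp
      ring
    rw [hx'] at hcomb
    rw [hcomb]
    field_simp
    ring
  obtain ⟨w, hsw, hwt⟩ := exists_between hst
  have hws : w - s ≠ 0 := (sub_pos.2 hsw).ne'
  have hw : w ∈ Set.Ico s t := ⟨hsw.le, hwt⟩
  refine ⟨fun i => (q w i - q s i) / (w - s), fun i => q s i - (q w i - q s i) / (w - s) * s,
    fun p hp i => ?_⟩
  have hk : (q p i - q s i) * (w - s) = (q w i - q s i) * (p - s) := by
    rcases le_total p w with hpw | hwp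
    · exact key p hp w hw hsw hpw i
    · exact (key w hw p hp (hsw.trans_le hwp) hwp i).symm
  have hk' : q p i - q s i = (q w i - q s i) / (w - s) * (p - s) := by
    rw [div_mul_eq_mul_div, eq_div_iff hws, hk]
  linarith

/-- A finite family of reals can be listed in antitone order. -/
lemma exists_antitone_comp_perm {m : ℕ} (u : Fin m → ℝ) :
    ∃ σ : Equiv.Perm (Fin m), Antitone (u ∘ σ) :=
  ⟨Tuple.sort fun i => -u i, fun _ _ hxy =>
    neg_le_neg_iff.1 (Tuple.monotone_sort (fun i => -u i) hxy)⟩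

/-- with non-negative influences, the pessimistic-equilibrium
function `p ↦ q̲(p)` is piecewise affine with at most `2n+1` pieces: there are
`m ≤ 2n` threshold prices `p₁ ≥ p₂ ≥ ⋯ ≥ p_m` (given as an antitone
`ps : Fin m → ℝ`) such that `q̲(p) = 0` for every `p ≥ p₁`, `q̲(p) = 1` for
every `p < p_m`, and on each interval `[p_{t+1}, p_t)` every coordinate of
`q̲(p)` is an affine function of `p`. -/
theorem pessimistic_piecewise_affine (n : ℕ) (a b : Fin n → ℝ)
    (T : Matrix (Fin n) (Fin n) ℝ)
    (ha : ∀ i, 0 ≤ a i) (hab : ∀ i, a i < b i)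
    (hTdiag : ∀ i, T i i = 0) (hTnn : ∀ i j, 0 ≤ T j i)
    (qlow : ℝ → Fin n → ℝ)
    (hqlow : ∀ p i, Tendsto (fun m : ℕ => (transfer a b T p)^[m] (fun _ => 0) i)
      atTop (𝓝 (qlow p i))) :
    ∃ m : ℕ, m ≤ 2 * n ∧ ∃ ps : Fin m → ℝ, Antitone ps ∧
      (∀ p : ℝ, (∀ t, ps t ≤ p) → ∀ i, qlow p i = 0) ∧
      (∀ p : ℝ, (∀ t, p < ps t) → ∀ i, qlow p i = 1) ∧
      (∀ t : Fin m, ∀ ht : t.1 + 1 < m, ∃ c d : Fin n → ℝ,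
        ∀ p ∈ Set.Ico (ps ⟨t.1 + 1, ht⟩) (ps t), ∀ i,
          qlow p i = c i * p + d i) := by
  have hq := isLeastEquilibrium_of_tendsto hab hTnn hqlow
  choose z hz using hq.exists_zero_threshold hab hTnn
  choose o ho1 ho using hq.exists_one_threshold hab hTnn
  let e : Fin (2 * n) ≃ Fin n ⊕ Fin n := (finCongr (two_mul n)).trans finSumFinEquiv.symm
  obtain ⟨σ, hσ⟩ := exists_antitone_comp_perm (Sum.elim z o ∘ e)
  have hsurj : ∀ y, ∃ k, Sum.elim z o y = (Sum.elim z o ∘ e) (σ k) := fun y =>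
    ⟨σ.symm (e.symm y), by simp⟩
  refine ⟨2 * n, le_rfl, _, hσ, fun p hp i => ?_, fun p hp i => ?_, fun t ht => ?_⟩
  · obtain ⟨k, hk⟩ := hsurj (.inl i)
    exact (hz i p).2 (hk.trans_le (hp k))
  · obtain ⟨k, hk⟩ := hsurj (.inr i)
    exact ho1 i p ((hp k).trans_eq hk.symm)
  · have hcut : ∀ y, Sum.elim z o y ≤ (Sum.elim z o ∘ e) (σ ⟨t.1 + 1, ht⟩) ∨
        (Sum.elim z o ∘ e) (σ t) ≤ Sum.elim z o y := fun y => by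
      obtain ⟨k, hk⟩ := hsurj y
      rw [hk]
      rcases le_or_gt k t with hkt | hkt
      · exact .inr (hσ hkt)
      · exact .inl (hσ (Fin.mk_le_of_le_val hkt))
    refine exists_affine_of_convex_combination fun p hp p' hp' l hl0 hl1 =>
      hq.convex_combination hab hTnn (fun i => ?_) hp hp' hl0 hl1
    rcases hcut (.inl i) with hzi | hzi
    · exact .inl fun p hp => (hz i p).2 (hzi.trans hp.1)
    rcases hcut (.inr i) with hoi | hoi
    · refine .inr (.inr fun p hp => ?_)
      have hpos : 0 < qlow p i := (hq.nonneg p i).lt_of_ne'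
        fun h => absurd ((hz i p).1 h) (not_le.2 (hp.2.trans_le hzi))
      refine ⟨hpos, (hq.apply_eq p i).trans (med_of_mem_Icc ?_ (ho i p (hoi.trans hp.1)))⟩
      by_contra! h
      exact hpos.ne' ((hq.apply_eq p i).trans (med_of_nonpos h.le))
    · exact .inr (.inl fun p hp => ho1 i p (hp.2.trans_le hoi))
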